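/- Let N ≥ 1, fix real constants c₁,…,c_N and a bounded sequence (ω^{(n)})_{n∈ℤ} in ℝ^N. Let E ∈ ℂ with Im E ≠ 0. Then there exists a unique matrix-valued function F₊ : ℝ → M_N(ℂ) such that: each column of F₊ is continuous on ℝ, is twice continuously differentiable on each interval (n, n+1) (n ∈ ℤ) where it satisfies −u'' + V₀·u = E·u, and at every n ∈ ℤ its components have one-sided derivatives satisfying u_i'(n⁺) = u_i'(n⁻) + c_i·ω_i^{(n)}·u_i(n) for each i; F₊(0) = I_N; and ∫₀^{+∞} ‖F₊(x)‖² dx < +∞. Similarly there exists a unique such F₋ : ℝ → M_N(ℂ) with F₋(0) = I_N and ∫_{−∞}^{0} ‖F₋(x)‖² dx < +∞. -/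

import Mathlib

open Matrix MeasureTheory

noncomputable section

/-- The N×N matrix with 1 on the upper and lower diagonals and 0 elsewhere. -/
def V0 (N : ℕ) : Matrix (Fin N) (Fin N) ℝ :=
  Matrix.of fun i j => if |(i : ℤ) - (j : ℤ)| = 1 then 1 else 0

/-- u : ℝ → ℂ^N is a solution of the point interactions eigenvalue problem at
energy E: u is continuous on ℝ, twice continuously differentiable on each
interval (n, n+1) where it satisfies −u'' + V₀·u = E·u, and at every integer n
the one-sided derivatives exist and satisfy the jump condition
u_i'(n⁺) = u_i'(n⁻) + c_i·ω_i^{(n)}·u_i(n). -/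
def SolCond (N : ℕ) (c : Fin N → ℝ) (w : ℤ → Fin N → ℝ) (E : ℂ)
    (u : ℝ → Fin N → ℂ) : Prop :=
  Continuous u ∧
  ∃ u' u'' : ℝ → Fin N → ℂ,
    (∀ n : ℤ, ∀ x ∈ Set.Ioo (n : ℝ) ((n : ℝ) + 1),
        HasDerivAt u (u' x) x ∧ HasDerivAt u' (u'' x) x) ∧
    (∀ n : ℤ, ContinuousOn u'' (Set.Ioo (n : ℝ) ((n : ℝ) + 1))) ∧
    (∀ n : ℤ, ∀ x ∈ Set.Ioo (n : ℝ) ((n : ℝ) + 1),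
        -u'' x + ((V0 N).map (fun r => (r : ℂ))) *ᵥ u x = E • u x) ∧
    (∀ n : ℤ, ∃ L R : Fin N → ℂ,
        HasDerivWithinAt u L (Set.Iio (n : ℝ)) (n : ℝ) ∧
        HasDerivWithinAt u R (Set.Ioi (n : ℝ)) (n : ℝ) ∧
        ∀ i, R i = L i + ((c i * w n i : ℝ) : ℂ) * u (n : ℝ) i)

open Set Filter Topology

namespace PointInteraction

section Flow

variable {X : Type*} [NormedAddCommGroup X] [NormedSpace ℝ X]

/-- The flow of the autonomous linear differential equation `y' = A y`. -/
def flow (A : X →L[ℝ] X) (t : ℝ) : X →L[ℝ] X :=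
  NormedSpace.exp (t • A)

variable (A : X →L[ℝ] X)

@[simp]
lemma flow_zero (s : X) : flow A 0 s = s := by
  simp [flow]

variable [CompleteSpace X]

lemma flow_add (a b : ℝ) (s : X) : flow A (a + b) s = flow A a (flow A b s) := by
  have h : Commute (a • A) (b • A) := ((Commute.refl _).smul_left a).smul_right b
  let _ : NormedAlgebra ℚ (X →L[ℝ] X) := NormedAlgebra.restrictScalars ℚ ℝ _
  rw [flow, add_smul, NormedSpace.exp_add_of_commute h]
  rfl

@[simp]
lemma flow_neg_self (a : ℝ) (s : X) : flow A (-a) (flow A a s) = s := by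
  rw [← flow_add, neg_add_cancel, flow_zero]

@[simp]
lemma flow_self_neg (a : ℝ) (s : X) : flow A a (flow A (-a) s) = s := by
  rw [← flow_add, add_neg_cancel, flow_zero]

lemma hasDerivAt_flow (t : ℝ) : HasDerivAt (flow A) (A * flow A t) t :=
  hasDerivAt_exp_smul_const' A t

lemma hasDerivAt_flow_apply (s : X) (t : ℝ) :
    HasDerivAt (fun t => flow A t s) (A (flow A t s)) t := by
  simpa using (hasDerivAt_flow A t).clm_apply (hasDerivAt_const t s)

lemma hasDerivAt_flow_sub (s : X) (a x : ℝ) :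
    HasDerivAt (fun x => flow A (x - a) s) (A (flow A (x - a) s)) x :=
  (hasDerivAt_flow_apply A s (x - a)).comp_sub_const x a

lemma continuous_flow : Continuous (flow A) :=
  continuous_iff_continuousAt.2 fun t => (hasDerivAt_flow A t).continuousAt

lemma continuous_flow_apply : Continuous fun p : X × ℝ => flow A p.2 p.1 :=
  ((continuous_flow A).comp continuous_snd).clm_apply continuous_fst

variable {A}

/-- A solution of `y' = A y` on an open interval is given by the flow. -/
lemma eq_flow_of_hasDerivAt {y : ℝ → X} {a b m x : ℝ}
    (hy : ∀ x ∈ Ioo a b, HasDerivAt y (A (y x)) x) (hm : m ∈ Ioo a b) (hx : x ∈ Ioo a b) :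
    y x = flow A (x - m) (y m) := by
  have hz : ∀ x ∈ Ioo a b, HasDerivAt (fun x => flow A (-x) (y x)) 0 x := by
    intro x hx
    have h1 : HasDerivAt (fun x : ℝ => flow A (-x)) (-(flow A (-x) * A)) x := by
      have h := (hasDerivAt_exp_smul_const A (-x)).scomp x (hasDerivAt_neg x)
      rw [neg_one_smul] at h
      exact h
    convert h1.clm_apply (hy x hx) using 1
    simp
  have hc := isOpen_Ioo.is_const_of_deriv_eq_zero (𝕜 := ℝ) isPreconnected_Ioo
    (fun x hx => (hz x hx).differentiableAt.differentiableWithinAt)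
    (fun x hx => (hz x hx).deriv) hx hm
  rw [sub_eq_add_neg, flow_add, ← hc, flow_self_neg]

end Flow

/-- Cauchy data `(u, u')` of a solution at a point. -/
abbrev CauchyData (N : ℕ) : Type := (Fin N → ℂ) × (Fin N → ℂ)

/-- The matrix `V₀ - E`. -/
def shiftedPotential (N : ℕ) (E : ℂ) : Matrix (Fin N) (Fin N) ℂ :=
  (V0 N).map (fun r => (r : ℂ)) - E • 1

/-- The generator `(u, v) ↦ (v, (V₀ - E) u)` of the free evolution. -/
def generator (N : ℕ) (E : ℂ) : CauchyData N →L[ℝ] CauchyData N :=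
  LinearMap.toContinuousLinearMap
    { toFun := fun s => (s.2, shiftedPotential N E *ᵥ s.1)
      map_add' := fun s t => by simp [Matrix.mulVec_add]
      map_smul' := fun r s => by simp [Matrix.mulVec_smul] }

variable {N : ℕ} {E : ℂ}

lemma generator_apply (s : CauchyData N) :
    generator N E s = (s.2, shiftedPotential N E *ᵥ s.1) := rfl

lemma shiftedPotential_mulVec (x : Fin N → ℂ) :
    shiftedPotential N E *ᵥ x = ((V0 N).map (fun r => (r : ℂ))) *ᵥ x - E • x := by
  simp [shiftedPotential, Matrix.sub_mulVec, Matrix.smul_mulVec]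

lemma hasDerivAt_fst_flow_sub (s : CauchyData N) (a x : ℝ) :
    HasDerivAt (fun x => (flow (generator N E) (x - a) s).1)
      (flow (generator N E) (x - a) s).2 x := by
  simpa [generator_apply] using
    HasFDerivAt.hasDerivAt (hasDerivAt_flow_sub (generator N E) s a x).hasFDerivAt.fst

lemma hasDerivAt_snd_flow_sub (s : CauchyData N) (a x : ℝ) :
    HasDerivAt (fun x => (flow (generator N E) (x - a) s).2)
      (shiftedPotential N E *ᵥ (flow (generator N E) (x - a) s).1) x := by
  simpa [generator_apply] using
    HasFDerivAt.hasDerivAt (hasDerivAt_flow_sub (generator N E) s a x).hasFDerivAt.snd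

/-- Free evolution over a unit interval followed by a point interaction of strength `d`. -/
def step (E : ℂ) (d : Fin N → ℝ) : CauchyData N ≃ₗ[ℝ] CauchyData N where
  toFun s := ((flow (generator N E) 1 s).1,
    (flow (generator N E) 1 s).2 + fun i => (d i : ℂ) * (flow (generator N E) 1 s).1 i)
  invFun s := flow (generator N E) (-1) (s.1, s.2 - fun i => (d i : ℂ) * s.1 i)
  map_add' s t := by
    ext i <;> simp; ring
  map_smul' r s := by
    ext i <;> simp; ring
  left_inv s := by simp
  right_inv s := by simp

lemma step_apply (d : Fin N → ℝ) (s : CauchyData N) :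
    step E d s = ((flow (generator N E) 1 s).1,
      (flow (generator N E) 1 s).2 + fun i => (d i : ℂ) * (flow (generator N E) 1 s).1 i) := rfl

variable {c : Fin N → ℝ} {w : ℤ → Fin N → ℝ} {u : ℝ → Fin N → ℂ}

lemma exists_data_of_solCond (hu : SolCond N c w E u) :
    ∃ s : ℤ → CauchyData N,
      (∀ n, s (n + 1) = step E (fun i => c i * w (n + 1) i) (s n)) ∧
      ∀ n : ℤ, ∀ x ∈ Icc (n : ℝ) (n + 1), u x = (flow (generator N E) (x - n) (s n)).1 := by
  obtain ⟨hcont, u', u'', hd, -, heq, hjump⟩ := hu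
  have hsol : ∀ n : ℤ, ∀ x ∈ Ioo (n : ℝ) (n + 1),
      HasDerivAt (fun x => (u x, u' x)) (generator N E (u x, u' x)) x := by
    intro n x hx
    have hgen : generator N E (u x, u' x) = (u' x, u'' x) := by
      rw [generator_apply, shiftedPotential_mulVec, ← heq n x hx, sub_add_cancel_right, neg_neg]
    rw [hgen]
    exact (hd n x hx).1.prodMk (hd n x hx).2
  have hs : ∃ s : ℤ → CauchyData N, ∀ n : ℤ, ∀ x ∈ Icc (n : ℝ) (n + 1),
      u x = (flow (generator N E) (x - n) (s n)).1 := by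
    refine ⟨fun n => flow (generator N E) (-(1 / 2)) (u (n + 1 / 2), u' (n + 1 / 2)), fun n => ?_⟩
    have hmid : (n : ℝ) + 1 / 2 ∈ Ioo (n : ℝ) (n + 1) := by constructor <;> linarith
    have hIoo : EqOn u (fun x => (flow (generator N E) (x - n)
        (flow (generator N E) (-(1 / 2)) (u (n + 1 / 2), u' (n + 1 / 2)))).1)
        (Ioo (n : ℝ) (n + 1)) := by
      intro x hx
      have h := eq_flow_of_hasDerivAt (hsol n) hmid hx
      simp only [← flow_add]
      rw [show x - (n : ℝ) + -(1 / 2) = x - (n + 1 / 2) by ring, ← h]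
    have hclosure := hIoo.closure hcont (continuous_fst.comp
      ((continuous_flow_apply _).comp (continuous_const.prodMk
        (continuous_id.sub continuous_const))))
    rwa [closure_Ioo (by linarith)] at hclosure
  obtain ⟨s, hs⟩ := hs
  refine ⟨s, fun n => ?_, hs⟩
  obtain ⟨L, R, hL, hR, hLR⟩ := hjump (n + 1)
  have hL' : HasDerivWithinAt u (flow (generator N E) 1 (s n)).2 (Iio ((n + 1 : ℤ) : ℝ))
      ((n + 1 : ℤ) : ℝ) := by
    have h := (hasDerivAt_fst_flow_sub (E := E) (s n) n (n + 1)).hasDerivWithinAt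
      (s := Iio ((n : ℝ) + 1))
    push_cast
    simp only [add_sub_cancel_left] at h
    refine h.congr_of_eventuallyEq ?_ (hs n _ (by constructor <;> linarith))
    filter_upwards [Ioo_mem_nhdsLT (show (n : ℝ) < n + 1 by linarith)] with x hx
    exact hs n x (Ioo_subset_Icc_self hx)
  have hR' : HasDerivWithinAt u (s (n + 1)).2 (Ioi ((n + 1 : ℤ) : ℝ)) ((n + 1 : ℤ) : ℝ) := by
    have h := (hasDerivAt_fst_flow_sub (E := E) (s (n + 1)) ((n + 1 : ℤ) : ℝ)
      ((n + 1 : ℤ) : ℝ)).hasDerivWithinAt (s := Ioi ((n + 1 : ℤ) : ℝ))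
    simp only [sub_self, flow_zero] at h
    refine h.congr_of_eventuallyEq ?_ (by
      simpa using hs (n + 1) ((n + 1 : ℤ) : ℝ) (by constructor <;> linarith))
    filter_upwards [Ioo_mem_nhdsGT (show ((n + 1 : ℤ) : ℝ) < ((n + 1 : ℤ) : ℝ) + 1 by linarith)]
      with x hx
    exact hs (n + 1) x (Ioo_subset_Icc_self hx)
  have hLeq := (uniqueDiffWithinAt_Iio _).eq_deriv _ hL hL'
  have hReq := (uniqueDiffWithinAt_Ioi _).eq_deriv _ hR hR'
  have hu1 : u ((n + 1 : ℤ) : ℝ) = (flow (generator N E) 1 (s n)).1 := by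
    rw [hs n _ (by push_cast; constructor <;> linarith)]
    simp
  have hu2 : u ((n + 1 : ℤ) : ℝ) = (s (n + 1)).1 := by
    rw [hs (n + 1) _ (by constructor <;> linarith)]
    simp
  rw [step_apply]
  refine Prod.ext (hu2.symm.trans hu1) ?_
  ext i
  rw [← hReq, hLR i, hLeq, hu1]
  rfl

lemma solCond_of_data {s : ℤ → CauchyData N}
    (hstep : ∀ n, s (n + 1) = step E (fun i => c i * w (n + 1) i) (s n))
    (hs : ∀ n : ℤ, ∀ x ∈ Icc (n : ℝ) (n + 1), u x = (flow (generator N E) (x - n) (s n)).1) :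
    SolCond N c w E u := by
  have hR : ∀ n : ℤ, HasDerivWithinAt u (s n).2 (Ioi (n : ℝ)) n := by
    intro n
    have h := (hasDerivAt_fst_flow_sub (E := E) (s n) n n).hasDerivWithinAt
      (s := Ioi (n : ℝ))
    simp only [sub_self, flow_zero] at h
    refine h.congr_of_eventuallyEq ?_ (by
      simpa using hs n n (by constructor <;> linarith))
    filter_upwards [Ioo_mem_nhdsGT (show (n : ℝ) < n + 1 by linarith)] with x hx
    exact hs n x (Ioo_subset_Icc_self hx)
  have hL : ∀ n : ℤ,
      HasDerivWithinAt u (flow (generator N E) 1 (s (n - 1))).2 (Iio (n : ℝ)) n := by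
    intro n
    have h := (hasDerivAt_fst_flow_sub (E := E) (s (n - 1)) ((n - 1 : ℤ) : ℝ)
      n).hasDerivWithinAt (s := Iio (n : ℝ))
    have h1 : (n : ℝ) - ((n - 1 : ℤ) : ℝ) = 1 := by push_cast; ring
    simp only [h1] at h
    refine h.congr_of_eventuallyEq ?_ ?_
    · filter_upwards [Ioo_mem_nhdsLT (show ((n - 1 : ℤ) : ℝ) < n by linarith)] with x hx
      exact hs (n - 1) x ⟨hx.1.le, by linarith [hx.2]⟩
    · exact hs (n - 1) n ⟨by linarith, by linarith⟩
  have hval : ∀ (n : ℤ), ∀ x ∈ Ioo (n : ℝ) (n + 1), ⌊x⌋ = n := fun n x hx =>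
    Int.floor_eq_iff.2 ⟨hx.1.le, hx.2⟩
  have hu : ∀ n : ℤ, ∀ x ∈ Ioo (n : ℝ) (n + 1),
      HasDerivAt u (flow (generator N E) (x - n) (s n)).2 x := by
    intro n x hx
    refine (hasDerivAt_fst_flow_sub (E := E) (s n) n x).congr_of_eventuallyEq ?_
    filter_upwards [Ioo_mem_nhds hx.1 hx.2] with y hy
    exact hs n y (Ioo_subset_Icc_self hy)
  refine ⟨?_, fun x => (flow (generator N E) (x - ⌊x⌋) (s ⌊x⌋)).2,
    fun x => shiftedPotential N E *ᵥ u x, fun n x hx => ⟨?_, ?_⟩, ?_, ?_, fun n => ?_⟩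
  · refine continuous_iff_continuousAt.2 fun x => ?_
    rcases eq_or_lt_of_le (Int.floor_le x) with h | h
    · rw [← h]
      exact continuousAt_iff_continuous_left'_right'.2
        ⟨(hL _).continuousWithinAt, (hR _).continuousWithinAt⟩
    · exact (hu ⌊x⌋ x ⟨h, Int.lt_floor_add_one x⟩).continuousAt
  · simpa only [hval n x hx] using hu n x hx
  · have h := hasDerivAt_snd_flow_sub (E := E) (s n) n x
    rw [← hs n x (Ioo_subset_Icc_self hx)] at h
    refine h.congr_of_eventuallyEq ?_
    filter_upwards [Ioo_mem_nhds hx.1 hx.2] with y hy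
    simp only [hval n y hy]
  · intro n x hx
    have hmul : Continuous fun y : Fin N → ℂ => shiftedPotential N E *ᵥ y :=
      Continuous.matrix_mulVec continuous_const continuous_id
    exact hmul.continuousAt.comp_continuousWithinAt
      (hu n x hx).continuousAt.continuousWithinAt
  · intro n x hx
    simp [shiftedPotential_mulVec]
  · refine ⟨_, _, hL n, hR n, fun i => ?_⟩
    have h := hstep (n - 1)
    rw [sub_add_cancel, step_apply] at h
    have hun : u n = (s n).1 := by simpa using hs n n (by constructor <;> linarith)
    rw [hun, h]
    rfl

/-- The squared `L²` norm over a unit interval of the free solution with Cauchy data `s`. -/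
def mass (E : ℂ) (s : CauchyData N) : ℝ :=
  ∫ t in (0 : ℝ)..1, ∑ i, ‖(flow (generator N E) t s).1 i‖ ^ 2

/-- `Im E * Im ⟨u, u'⟩`, which is invariant under point interactions and decreases along the free
evolution. -/
def energyForm (E : ℂ) (s : CauchyData N) : ℝ :=
  E.im * ∑ i, (star (s.1 i) * s.2 i).im

lemma continuous_flow_fst_norm_sq :
    Continuous fun p : CauchyData N × ℝ =>
      ∑ i, ‖(flow (generator N E) p.2 p.1).1 i‖ ^ 2 := by
  have h : Continuous fun p : CauchyData N × ℝ => (flow (generator N E) p.2 p.1).1 :=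
    continuous_fst.comp (continuous_flow_apply _)
  fun_prop

lemma continuous_flow_apply_fst_norm_sq (s : CauchyData N) :
    Continuous fun t => ∑ i, ‖(flow (generator N E) t s).1 i‖ ^ 2 := by
  have h : Continuous fun t => (flow (generator N E) t s).1 :=
    continuous_fst.comp ((continuous_flow (generator N E)).clm_apply continuous_const)
  fun_prop

lemma continuous_mass : Continuous (mass E : CauchyData N → ℝ) :=
  intervalIntegral.continuous_parametric_intervalIntegral_of_continuous'
    (f := fun s t => ∑ i, ‖(flow (generator N E) t s).1 i‖ ^ 2) continuous_flow_fst_norm_sq 0 1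

lemma continuous_energyForm : Continuous (energyForm E : CauchyData N → ℝ) := by
  unfold energyForm
  fun_prop

lemma mass_nonneg (s : CauchyData N) : 0 ≤ mass E s :=
  intervalIntegral.integral_nonneg zero_le_one fun t _ => by positivity

lemma mass_smul (r : ℝ) (s : CauchyData N) : mass E (r • s) = r ^ 2 * mass E s := by
  rw [mass, mass, ← intervalIntegral.integral_const_mul]
  congr 1
  ext t
  rw [map_smul, Finset.mul_sum]
  refine Finset.sum_congr rfl fun i _ => ?_
  rw [Prod.smul_fst, Pi.smul_apply, norm_smul, mul_pow, Real.norm_eq_abs, sq_abs]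

lemma eq_zero_of_mass_eq_zero {s : CauchyData N} (hs : mass E s = 0) : s = 0 := by
  have hzero : ∀ t ∈ Icc (0 : ℝ) 1, (flow (generator N E) t s).1 = 0 := by
    intro t ht
    by_contra hne
    obtain ⟨i, hi⟩ := Function.ne_iff.1 hne
    have hpos : 0 < ∑ i, ‖(flow (generator N E) t s).1 i‖ ^ 2 :=
      Finset.sum_pos' (fun i _ => by positivity)
        ⟨i, Finset.mem_univ i, pow_pos (norm_pos_iff.2 hi) 2⟩
    exact (intervalIntegral.integral_pos zero_lt_one
      (continuous_flow_apply_fst_norm_sq s).continuousOn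
      (fun t _ => by positivity) ⟨t, ht, hpos⟩).ne' hs
  have h1 : s.1 = 0 := by simpa using hzero 0 (by simp)
  have h2 : s.2 = 0 := by
    have hd := (hasDerivAt_fst_flow_sub (E := E) s 0 0).hasDerivWithinAt (s := Ioi (0 : ℝ))
    simp only [sub_zero, flow_zero] at hd
    refine (uniqueDiffWithinAt_Ioi _).eq_deriv _ hd
      ((hasDerivWithinAt_const (0 : ℝ) (Ioi 0) (0 : Fin N → ℂ)).congr_of_eventuallyEq ?_ ?_)
    · filter_upwards [Ioo_mem_nhdsGT (zero_lt_one (α := ℝ))] with x hx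
      exact hzero x (Ioo_subset_Icc_self hx)
    · simpa using h1
  exact Prod.ext h1 h2

lemma exists_norm_sq_le_mass (N : ℕ) (E : ℂ) :
    ∃ C, 0 < C ∧ ∀ s : CauchyData N, ‖s‖ ^ 2 ≤ C * mass E s := by
  rcases (Metric.sphere (0 : CauchyData N) 1).eq_empty_or_nonempty with hem | hne
  · refine ⟨1, one_pos, fun s => ?_⟩
    by_cases hs : s = 0
    · simpa [hs] using mass_nonneg (0 : CauchyData N)
    · exact absurd (hem ▸ (by simp [norm_smul, hs] : ‖s‖⁻¹ • s ∈ Metric.sphere 0 1))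
        (notMem_empty _)
  · obtain ⟨s₀, hs₀, hmin⟩ :=
      (isCompact_sphere (0 : CauchyData N) 1).exists_isMinOn hne continuous_mass.continuousOn
    have hpos : 0 < mass E s₀ := (mass_nonneg s₀).lt_of_ne' fun h => by
      simp [eq_zero_of_mass_eq_zero h] at hs₀
    refine ⟨(mass E s₀)⁻¹, inv_pos.2 hpos, fun s => ?_⟩
    by_cases hs : s = 0
    · simpa [hs] using mul_nonneg (inv_nonneg.2 hpos.le) (mass_nonneg (E := E) (0 : CauchyData N))
    · have hsn : 0 < ‖s‖ := norm_pos_iff.2 hs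
      have h := hmin (by simp [norm_smul, hs] : ‖s‖⁻¹ • s ∈ Metric.sphere 0 1)
      simp only [mem_ofPred_eq, mass_smul] at h
      rw [inv_pow, inv_mul_eq_div, le_div_iff₀ (by positivity)] at h
      rw [inv_mul_eq_div, le_div_iff₀ hpos, mul_comm]
      exact h

lemma im_star_dotProduct_shiftedPotential (x : Fin N → ℂ) :
    (star x ⬝ᵥ (shiftedPotential N E *ᵥ x)).im = -E.im * ∑ i, ‖x i‖ ^ 2 := by
  have hherm : ((V0 N).map (fun r => (r : ℂ))).IsHermitian := by
    ext i j
    simp only [V0, conjTranspose_apply, map_apply, of_apply, abs_sub_comm (j : ℤ)]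
    split_ifs <;> simp
  have hreal : (star x ⬝ᵥ (((V0 N).map (fun r => (r : ℂ))) *ᵥ x)).im = 0 :=
    hherm.im_star_dotProduct_mulVec_self x
  have hsq : star x ⬝ᵥ x = ((∑ i, ‖x i‖ ^ 2 : ℝ) : ℂ) := by
    simp [dotProduct, Complex.conj_mul']
  rw [shiftedPotential_mulVec, dotProduct_sub, Complex.sub_im, hreal, dotProduct_smul, hsq,
    smul_eq_mul, Complex.im_mul_ofReal]
  ring

lemma hasDerivAt_energyForm (s : CauchyData N) (t : ℝ) :
    HasDerivAt (fun t => energyForm E (flow (generator N E) t s))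
      (-E.im ^ 2 * ∑ i, ‖(flow (generator N E) t s).1 i‖ ^ 2) t := by
  have h1 := hasDerivAt_fst_flow_sub (E := E) s 0 t
  have h2 := hasDerivAt_snd_flow_sub (E := E) s 0 t
  simp only [sub_zero] at h1 h2
  have h := (HasDerivAt.fun_sum fun i (_ : i ∈ Finset.univ) =>
    Complex.imCLM.hasFDerivAt.comp_hasDerivAt t
      ((hasDerivAt_pi.1 h1 i).star.mul (hasDerivAt_pi.1 h2 i))).const_mul E.im
  refine h.congr_deriv ?_
  have hself : ∀ z : ℂ, (star z * z).im = 0 := fun z => by simp [mul_comm]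
  have him := im_star_dotProduct_shiftedPotential (E := E) (flow (generator N E) t s).1
  simp only [dotProduct, Complex.im_sum] at him
  simp only [Complex.imCLM_apply, Complex.add_im, hself, zero_add]
  refine (congrArg (E.im * ·) him).trans ?_
  ring

lemma energyForm_step (d : Fin N → ℝ) (s : CauchyData N) :
    energyForm E (step E d s) = energyForm E s - E.im ^ 2 * mass E s := by
  have hjump : energyForm E (step E d s) = energyForm E (flow (generator N E) 1 s) := by
    simp only [energyForm, step_apply]
    congr 1
    refine Finset.sum_congr rfl fun i _ => ?_
    simp
    ring
  have hcont : Continuous fun t => -E.im ^ 2 * ∑ i, ‖(flow (generator N E) t s).1 i‖ ^ 2 :=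
    continuous_const.mul (continuous_flow_apply_fst_norm_sq s)
  have hInt := intervalIntegral.integral_eq_sub_of_hasDerivAt
    (fun t _ => hasDerivAt_energyForm (E := E) s t) (hcont.intervalIntegrable 0 1)
  rw [intervalIntegral.integral_const_mul, flow_zero] at hInt
  rw [hjump, mass]
  linarith

/-- The Cauchy data just after the point `n`, as a function of those just after `0`. -/
def forward (E : ℂ) (d : ℤ → Fin N → ℝ) : ℕ → CauchyData N →ₗ[ℝ] CauchyData N
  | 0 => LinearMap.id
  | n + 1 => (step E (d (n + 1))).toLinearMap ∘ₗ forward E d n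

lemma continuous_forward (d : ℤ → Fin N → ℝ) (n : ℕ) : Continuous (forward E d n) :=
  (forward E d n).continuous_of_finiteDimensional

lemma energyForm_forward_succ (d : ℤ → Fin N → ℝ) (n : ℕ) (s : CauchyData N) :
    energyForm E (forward E d (n + 1) s) =
      energyForm E (forward E d n s) - E.im ^ 2 * mass E (forward E d n s) :=
  energyForm_step _ _

lemma energyForm_forward_eq (d : ℤ → Fin N → ℝ) (n : ℕ) (s : CauchyData N) :
    energyForm E (forward E d n s) =
      energyForm E s - E.im ^ 2 * ∑ k ∈ Finset.range n, mass E (forward E d k s) := by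
  induction n with
  | zero => simp [forward]
  | succ n ih => rw [energyForm_forward_succ, ih, Finset.sum_range_succ]; ring

lemma antitone_energyForm_forward (d : ℤ → Fin N → ℝ) (s : CauchyData N) :
    Antitone fun n => energyForm E (forward E d n s) :=
  antitone_nat_of_succ_le fun n => by
    rw [energyForm_forward_succ]
    exact sub_le_self _ (mul_nonneg (sq_nonneg _) (mass_nonneg _))

lemma energyForm_of_fst_eq_zero {s : CauchyData N} (hs : s.1 = 0) : energyForm E s = 0 := by
  simp [energyForm, hs]

/-- Zero is the only solution with `u 0 = 0` whose energy form stays nonnegative. -/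
lemma eq_zero_of_energyForm_nonneg (hE : E.im ≠ 0) (d : ℤ → Fin N → ℝ) {s : CauchyData N}
    (hs : s.1 = 0) (h : 0 ≤ energyForm E (forward E d 1 s)) : s = 0 := by
  rw [energyForm_forward_eq, energyForm_of_fst_eq_zero hs] at h
  simp only [Finset.range_one, Finset.sum_singleton, forward, LinearMap.id_apply] at h
  have hE2 : 0 < E.im ^ 2 := by positivity
  refine eq_zero_of_mass_eq_zero (E := E) (le_antisymm ?_ (mass_nonneg s))
  by_contra! hpos
  linarith [mul_pos hE2 hpos]

/-- The Dirichlet problem on `[0, n + 1]` is solvable. -/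
lemma exists_forward_fst_eq_zero (hE : E.im ≠ 0) (d : ℤ → Fin N → ℝ) (e : Fin N → ℂ) (n : ℕ) :
    ∃ v, (forward E d (n + 1) (e, v)).1 = 0 := by
  let T : (Fin N → ℂ) →ₗ[ℝ] (Fin N → ℂ) :=
    LinearMap.fst ℝ _ _ ∘ₗ forward E d (n + 1) ∘ₗ LinearMap.inr ℝ _ _
  have hinj : Function.Injective T := by
    refine (injective_iff_map_eq_zero T).2 fun v hv => ?_
    have hend : energyForm E (forward E d (n + 1) ((0, v) : CauchyData N)) = 0 :=
      energyForm_of_fst_eq_zero hv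
    have h : 0 ≤ energyForm E (forward E d 1 ((0, v) : CauchyData N)) :=
      hend.ge.trans (antitone_energyForm_forward d (0, v) (Nat.le_add_left 1 n))
    exact congrArg Prod.snd (eq_zero_of_energyForm_nonneg hE d rfl h)
  obtain ⟨v, hv⟩ := LinearMap.injective_iff_surjective.1 hinj
    (-(forward E d (n + 1) (e, 0)).1)
  have hv' : (forward E d (n + 1) (0, v)).1 = -(forward E d (n + 1) (e, 0)).1 := hv
  refine ⟨v, ?_⟩
  have hsplit : ((e, v) : CauchyData N) = (e, 0) + (0, v) := by simp
  rw [hsplit, map_add, Prod.fst_add, hv', add_neg_cancel]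

lemma energyForm_le (s : CauchyData N) :
    energyForm E s ≤ |E.im| * (N * (‖s.1‖ * ‖s.2‖)) := by
  refine (le_abs_self _).trans ?_
  rw [energyForm, abs_mul]
  gcongr
  refine (Finset.abs_sum_le_sum_abs _ _).trans ?_
  refine (Finset.sum_le_card_nsmul _ _ (‖s.1‖ * ‖s.2‖) fun i _ => ?_).trans (by simp)
  refine (Complex.abs_im_le_norm _).trans ?_
  rw [norm_mul, norm_star]
  gcongr <;> exact norm_le_pi_norm _ i

/-- Every initial value extends to Cauchy data whose energy form stays nonnegative. -/
lemma exists_energyForm_nonneg (hE : E.im ≠ 0) (d : ℤ → Fin N → ℝ) (e : Fin N → ℂ) :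
    ∃ v, ∀ n, 0 ≤ energyForm E (forward E d n (e, v)) := by
  let K : ℕ → Set (Fin N → ℂ) := fun n => {v | 0 ≤ energyForm E (forward E d (n + 1) (e, v))}
  have hclosed : ∀ n, IsClosed (K n) := fun n =>
    isClosed_le continuous_const (continuous_energyForm.comp
      ((continuous_forward d (n + 1)).comp (continuous_const.prodMk continuous_id)))
  have hcompact : IsCompact (K 0) := by
    obtain ⟨C, hC, hbound⟩ := exists_norm_sq_le_mass N E
    refine Metric.isCompact_of_isClosed_isBounded (hclosed 0)
      ((Metric.isBounded_closedBall (x := 0)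
        (r := C * (|E.im| * (N * ‖e‖)) / E.im ^ 2)).subset fun v hv => ?_)
    have hE2 : 0 < E.im ^ 2 := by positivity
    have h0 : 0 ≤ energyForm E (forward E d 1 (e, v)) := hv
    rw [energyForm_forward_eq] at h0
    simp only [Finset.range_one, Finset.sum_singleton, forward, LinearMap.id_apply] at h0
    have h1 := energyForm_le (E := E) ((e, v) : CauchyData N)
    have h2 : ‖v‖ ^ 2 ≤ C * mass E (e, v) :=
      (pow_le_pow_left₀ (norm_nonneg v) (norm_snd_le (e, v)) 2).trans (hbound (e, v))
    rw [mem_closedBall_zero_iff, le_div_iff₀ hE2]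
    rcases (norm_nonneg v).eq_or_lt' with hv0 | hv0
    · rw [hv0, zero_mul]; positivity
    · refine le_of_mul_le_mul_right ?_ hv0
      calc ‖v‖ * E.im ^ 2 * ‖v‖ = E.im ^ 2 * ‖v‖ ^ 2 := by ring
        _ ≤ E.im ^ 2 * (C * mass E (e, v)) := by gcongr
        _ = C * (E.im ^ 2 * mass E (e, v)) := by ring
        _ ≤ C * (|E.im| * (N * (‖e‖ * ‖v‖))) :=
          mul_le_mul_of_nonneg_left (by linarith) hC.le
        _ = C * (|E.im| * (N * ‖e‖)) * ‖v‖ := by ring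
  obtain ⟨v, hv⟩ := IsCompact.nonempty_iInter_of_sequence_nonempty_isCompact_isClosed K
    (fun n v hv => le_trans hv (antitone_energyForm_forward d _ (Nat.le_succ _)))
    (fun n => (exists_forward_fst_eq_zero hE d e n).imp fun v hv =>
      (energyForm_of_fst_eq_zero hv).ge) hcompact hclosed
  rw [mem_iInter] at hv
  exact ⟨v, fun n => le_trans (hv n) (antitone_energyForm_forward d _ (Nat.le_succ _))⟩

lemma exists_int_orbit {X : Type*} (f : ℤ → X ≃ X) (a : X) :
    ∃ s : ℤ → X, s 0 = a ∧ ∀ n, s (n + 1) = f n (s n) := by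
  let neg : ℕ → X := fun k => Nat.rec a (fun k x => (f (-(k + 1 : ℕ))).symm x) k
  let pos : ℕ → X := fun k => Nat.rec a (fun k x => f k x) k
  refine ⟨fun n => if 0 ≤ n then pos n.toNat else neg (-n).toNat, rfl, fun n => ?_⟩
  rcases lt_or_ge n 0 with hn | hn
  · obtain ⟨k, rfl⟩ : ∃ k : ℕ, n = -(k + 1 : ℕ) := ⟨(-n - 1).toNat, by omega⟩
    have hneg : neg (k + 1) = (f (-(k + 1 : ℕ))).symm (neg k) := rfl
    have hk : (- -((k + 1 : ℕ) : ℤ)).toNat = k + 1 := by omega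
    have hk' : (-(-((k + 1 : ℕ) : ℤ) + 1)).toNat = k := by omega
    simp only [hn.not_ge, if_false, hk, hneg, Equiv.apply_symm_apply, hk']
    split_ifs with h
    · obtain rfl : k = 0 := by omega
      rfl
    · rfl
  · obtain ⟨k, rfl⟩ := Int.eq_ofNat_of_zero_le hn
    have hk : ((k : ℤ) + 1).toNat = k + 1 := by omega
    simp only [hn, if_true, hk, Int.toNat_natCast, show (0 : ℤ) ≤ k + 1 by omega]
    rfl

lemma int_orbit_unique {X : Type*} (f : ℤ → X ≃ X) {s t : ℤ → X} (h0 : s 0 = t 0)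
    (hs : ∀ n, s (n + 1) = f n (s n)) (ht : ∀ n, t (n + 1) = f n (t n)) : s = t := by
  ext n
  induction n with
  | zero => exact h0
  | succ n ih => rw [hs, ht, ih]
  | pred n ih =>
    refine (f (-(n : ℤ) - 1)).injective ?_
    rw [← hs, ← ht, sub_add_cancel, ih]

lemma orbit_natCast {d : ℤ → Fin N → ℝ} {s : ℤ → CauchyData N}
    (hs : ∀ n, s (n + 1) = step E (d (n + 1)) (s n)) (n : ℕ) :
    s n = forward E d n (s 0) := by
  induction n with
  | zero => rfl
  | succ n ih =>
    rw [Nat.cast_succ, hs, ih]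
    rfl

lemma integral_eq_sum_mass {s : ℤ → CauchyData N}
    (hu : Continuous u)
    (hs : ∀ n : ℤ, ∀ x ∈ Icc (n : ℝ) (n + 1), u x = (flow (generator N E) (x - n) (s n)).1)
    (n : ℕ) :
    ∫ x in (0 : ℝ)..n, ∑ i, ‖u x i‖ ^ 2 = ∑ k ∈ Finset.range n, mass E (s k) := by
  have hcont : Continuous fun x => ∑ i, ‖u x i‖ ^ 2 := by fun_prop
  rw [← Nat.cast_zero, ← intervalIntegral.sum_integral_adjacent_intervals
    (a := fun k : ℕ => (k : ℝ)) (fun k _ => hcont.intervalIntegrable _ _)]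
  refine Finset.sum_congr rfl fun k _ => ?_
  have hsub := intervalIntegral.integral_comp_sub_right (a := (k : ℝ)) (b := (k : ℝ) + 1)
    (fun t => ∑ i, ‖(flow (generator N E) t (s k)).1 i‖ ^ 2) (k : ℝ)
  rw [sub_self, add_sub_cancel_left] at hsub
  rw [mass, ← hsub, Nat.cast_succ]
  refine intervalIntegral.integral_congr fun x hx => ?_
  rw [uIcc_of_le (by linarith)] at hx
  simp only [hs k x hx, Int.cast_natCast]

/-- Every initial value extends to a solution which is square-integrable near `+∞`. -/
lemma exists_solCond_integrableOn_Ioi (hE : E.im ≠ 0) (c : Fin N → ℝ) (w : ℤ → Fin N → ℝ)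
    (e : Fin N → ℂ) :
    ∃ u, SolCond N c w E u ∧ u 0 = e ∧
      IntegrableOn (fun x => ∑ i, ‖u x i‖ ^ 2) (Ioi (0 : ℝ)) := by
  let d : ℤ → Fin N → ℝ := fun n i => c i * w n i
  obtain ⟨v, hv⟩ := exists_energyForm_nonneg hE d e
  obtain ⟨s, hs0, hstep⟩ := exists_int_orbit (fun n => (step E (d (n + 1))).toEquiv)
    ((e, v) : CauchyData N)
  let u : ℝ → Fin N → ℂ := fun x => (flow (generator N E) (x - ⌊x⌋) (s ⌊x⌋)).1
  have hs : ∀ n : ℤ, ∀ x ∈ Icc (n : ℝ) (n + 1),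
      u x = (flow (generator N E) (x - n) (s n)).1 := by
    intro n x hx
    rcases hx.2.eq_or_lt with h | h
    · have hfloor : ⌊x⌋ = n + 1 := by rw [h]; simp
      have hux : u x = (flow (generator N E) (x - (n + 1 : ℤ)) (s (n + 1))).1 := by
        simp only [u, hfloor]
      rw [hux, hstep, h, Int.cast_add, Int.cast_one, sub_self, add_sub_cancel_left, flow_zero]
      rfl
    · simp only [u, Int.floor_eq_iff.2 ⟨hx.1, h⟩]
  have hsol : SolCond N c w E u := solCond_of_data hstep hs
  have hcont : Continuous fun x => ∑ i, ‖u x i‖ ^ 2 := by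
    have := hsol.1
    fun_prop
  refine ⟨u, hsol, ?_, ?_⟩
  · simpa [hs0] using hs 0 0 (by simp)
  refine integrableOn_Ioi_of_intervalIntegral_norm_bounded
    (energyForm E ((e, v) : CauchyData N) / E.im ^ 2) 0
    (fun n : ℕ => (hcont.integrableOn_Icc).mono_set Ioc_subset_Icc_self)
    tendsto_natCast_atTop_atTop (Eventually.of_forall fun n => ?_)
  have hnorm : ∀ x, ‖∑ i, ‖u x i‖ ^ 2‖ = ∑ i, ‖u x i‖ ^ 2 := fun x =>
    Real.norm_of_nonneg (by positivity)
  simp only [hnorm]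
  rw [integral_eq_sum_mass hsol.1 hs, le_div_iff₀ (by positivity)]
  have h := hv n
  rw [energyForm_forward_eq] at h
  simp only [orbit_natCast hstep, hs0]
  linarith

/-- The Cauchy data of a solution which is square-integrable near `+∞` tend to zero. -/
lemma tendsto_data_zero {s : ℤ → CauchyData N} (hu : Continuous u)
    (hs : ∀ n : ℤ, ∀ x ∈ Icc (n : ℝ) (n + 1), u x = (flow (generator N E) (x - n) (s n)).1)
    (hInt : IntegrableOn (fun x => ∑ i, ‖u x i‖ ^ 2) (Ioi (0 : ℝ))) :
    Tendsto (fun n : ℕ => s n) atTop (𝓝 0) := by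
  obtain ⟨C, hC, hbound⟩ := exists_norm_sq_le_mass N E
  have hlim := intervalIntegral_tendsto_integral_Ioi 0 hInt
    (tendsto_natCast_atTop_atTop (R := ℝ))
  simp only [integral_eq_sum_mass hu hs] at hlim
  have hmass : Tendsto (fun n : ℕ => mass E (s n)) atTop (𝓝 0) := by
    have h := ((tendsto_add_atTop_iff_nat 1).2 hlim).sub hlim
    simpa [Finset.sum_range_succ] using h
  have hsq : Tendsto (fun n : ℕ => ‖s n‖ ^ 2) atTop (𝓝 0) :=
    squeeze_zero (fun n => by positivity) (fun n => hbound (s n))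
      (by simpa using hmass.const_mul C)
  refine tendsto_zero_iff_norm_tendsto_zero.2 ?_
  simpa [Real.sqrt_sq_eq_abs] using hsq.sqrt

lemma solCond_unique (hE : E.im ≠ 0) {u₁ u₂ : ℝ → Fin N → ℂ}
    (h₁ : SolCond N c w E u₁) (h₂ : SolCond N c w E u₂) (h0 : u₁ 0 = u₂ 0)
    (hInt₁ : IntegrableOn (fun x => ∑ i, ‖u₁ x i‖ ^ 2) (Ioi (0 : ℝ)))
    (hInt₂ : IntegrableOn (fun x => ∑ i, ‖u₂ x i‖ ^ 2) (Ioi (0 : ℝ))) : u₁ = u₂ := by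
  let d : ℤ → Fin N → ℝ := fun n i => c i * w n i
  obtain ⟨s₁, hstep₁, hs₁⟩ := exists_data_of_solCond h₁
  obtain ⟨s₂, hstep₂, hs₂⟩ := exists_data_of_solCond h₂
  have hfst : (s₁ 0 - s₂ 0).1 = 0 := by
    have e₁ := hs₁ 0 0 (by simp)
    have e₂ := hs₂ 0 0 (by simp)
    simp only [Int.cast_zero, sub_zero, flow_zero] at e₁ e₂
    rw [Prod.fst_sub, ← e₁, ← e₂, h0, sub_self]
  have hlim : Tendsto (fun n => energyForm E (forward E d n (s₁ 0 - s₂ 0))) atTop (𝓝 0) := by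
    have h := (tendsto_data_zero h₁.1 hs₁ hInt₁).sub (tendsto_data_zero h₂.1 hs₂ hInt₂)
    have h' := (continuous_energyForm (E := E)).tendsto ((0 : CauchyData N) - 0) |>.comp h
    rw [sub_zero, energyForm_of_fst_eq_zero (s := (0 : CauchyData N)) rfl] at h'
    refine h'.congr fun n => ?_
    rw [Function.comp_apply, orbit_natCast (d := d) hstep₁, orbit_natCast (d := d) hstep₂, map_sub]
  have hdata : s₁ 0 - s₂ 0 = 0 := eq_zero_of_energyForm_nonneg hE d hfst
    ((antitone_energyForm_forward d _).le_of_tendsto hlim 1)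
  have hs : s₁ = s₂ := int_orbit_unique (fun n => (step E (d (n + 1))).toEquiv)
    (sub_eq_zero.1 hdata) hstep₁ hstep₂
  ext1 x
  have hx : x ∈ Icc ((⌊x⌋ : ℤ) : ℝ) (⌊x⌋ + 1) := ⟨Int.floor_le x, (Int.lt_floor_add_one x).le⟩
  rw [hs₁ _ x hx, hs₂ _ x hx, hs]

lemma integrableOn_column {F : ℝ → Matrix (Fin N) (Fin N) ℂ} {S : Set ℝ} {j : Fin N}
    (hF : Continuous fun x i => F x i j)
    (hInt : IntegrableOn (fun x => ∑ i, ∑ j, ‖F x i j‖ ^ 2) S) :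
    IntegrableOn (fun x => ∑ i, ‖F x i j‖ ^ 2) S := by
  have hcont : Continuous fun x => ∑ i, ‖F x i j‖ ^ 2 := by
    have := fun i => (continuous_apply i).comp hF
    fun_prop
  refine Integrable.mono hInt hcont.aestronglyMeasurable (Eventually.of_forall fun x => ?_)
  rw [Real.norm_of_nonneg (by positivity), Real.norm_of_nonneg (by positivity)]
  gcongr with i
  exact Finset.single_le_sum (f := fun j => ‖F x i j‖ ^ 2) (fun j _ => by positivity)
    (Finset.mem_univ j)

/-- Existence and uniqueness of the matrix solution which is square-integrable near `+∞`. -/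
lemma existsUnique_integrableOn_Ioi (hE : E.im ≠ 0) (c : Fin N → ℝ) (w : ℤ → Fin N → ℝ) :
    ∃! F : ℝ → Matrix (Fin N) (Fin N) ℂ,
      (∀ j, SolCond N c w E (fun x i => F x i j)) ∧
      F 0 = 1 ∧
      IntegrableOn (fun x => ∑ i, ∑ j, ‖F x i j‖ ^ 2) (Ioi (0 : ℝ)) := by
  choose u hu hu0 hInt using fun j : Fin N =>
    exists_solCond_integrableOn_Ioi hE c w (fun i => (1 : Matrix (Fin N) (Fin N) ℂ) i j)
  refine ⟨fun x => Matrix.of fun i j => u j x i, ⟨hu, ?_, ?_⟩, ?_⟩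
  · ext i j
    exact congrFun (hu0 j) i
  · have hswap : (fun x => ∑ i, ∑ j, ‖Matrix.of (fun i j => u j x i) i j‖ ^ 2) =
        fun x => ∑ j, ∑ i, ‖u j x i‖ ^ 2 := funext fun x => Finset.sum_comm
    rw [hswap]
    exact integrable_finsetSum _ fun j _ => hInt j
  · rintro G ⟨hG, hG0, hGint⟩
    ext x i j
    have h := solCond_unique hE (hG j) (hu j) (by rw [hu0, hG0])
      (integrableOn_column (hG j).1 hGint) (hInt j)
    exact congrFun (congrFun h x) i

lemma hasDerivAt_comp_neg {X : Type*} [NormedAddCommGroup X] [NormedSpace ℝ X] {f : ℝ → X}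
    {f' : X} {x : ℝ} (hf : HasDerivAt f f' (-x)) : HasDerivAt (fun x => f (-x)) (-f') x := by
  have h := hf.scomp x (hasDerivAt_neg x)
  rwa [neg_one_smul] at h

lemma hasDerivWithinAt_comp_neg {X : Type*} [NormedAddCommGroup X] [NormedSpace ℝ X] {f : ℝ → X}
    {f' : X} {x : ℝ} {S T : Set ℝ} (hf : HasDerivWithinAt f f' T (-x)) (hST : MapsTo Neg.neg S T) :
    HasDerivWithinAt (fun x => f (-x)) (-f') S x := by
  have h := hf.scomp x (hasDerivAt_neg x).hasDerivWithinAt hST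
  rwa [neg_one_smul] at h

lemma solCond_comp_neg (hu : SolCond N c w E u) :
    SolCond N c (fun n => w (-n)) E (fun x => u (-x)) := by
  obtain ⟨hcont, u', u'', hd, hc, heq, hjump⟩ := hu
  have hmem : ∀ n : ℤ, ∀ x ∈ Ioo (n : ℝ) (n + 1),
      -x ∈ Ioo ((-n - 1 : ℤ) : ℝ) ((-n - 1 : ℤ) + 1) := by
    intro n x hx
    push_cast
    constructor <;> linarith [hx.1, hx.2]
  refine ⟨hcont.comp continuous_neg, fun x => -u' (-x), fun x => u'' (-x),
    fun n x hx => ⟨?_, ?_⟩, fun n => ?_, fun n x hx => heq _ _ (hmem n x hx), fun n => ?_⟩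
  · exact hasDerivAt_comp_neg (hd _ _ (hmem n x hx)).1
  · have h := (hasDerivAt_comp_neg (hd _ _ (hmem n x hx)).2).fun_neg
    rwa [neg_neg] at h
  · exact (hc (-n - 1)).comp continuous_neg.continuousOn (hmem n)
  · obtain ⟨L, R, hL, hR, hLR⟩ := hjump (-n)
    rw [Int.cast_neg] at hL hR hLR
    refine ⟨-R, -L, ?_, ?_, fun i => ?_⟩
    · exact hasDerivWithinAt_comp_neg hR fun x hx => mem_Ioi.2 (neg_lt_neg (mem_Iio.1 hx))
    · exact hasDerivWithinAt_comp_neg hL fun x hx => mem_Iio.2 (neg_lt_neg (mem_Ioi.1 hx))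
    · simp only [Pi.neg_apply, hLR]
      ring

lemma integrableOn_comp_neg {f : ℝ → ℝ} {S : Set ℝ} (hf : IntegrableOn f S) :
    IntegrableOn (fun x => f (-x)) (-S) :=
  ((Measure.measurePreserving_neg (volume : Measure ℝ)).integrableOn_comp_preimage
    (MeasurableEquiv.neg ℝ).measurableEmbedding).2 hf

end PointInteraction

/-- for nonreal E there is a unique matrix-valued solution F₊ with
F₊(0) = I whose columns are solutions and which is square-integrable near +∞, and
similarly a unique F₋ square-integrable near −∞. -/
theorem exists_unique_Fplus_Fminus (N : ℕ) (hN : 1 ≤ N) (c : Fin N → ℝ)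
    (w : ℤ → Fin N → ℝ) (hw : ∃ Cb : ℝ, ∀ n i, |w n i| ≤ Cb)
    (E : ℂ) (hE : E.im ≠ 0) :
    (∃! F : ℝ → Matrix (Fin N) (Fin N) ℂ,
      (∀ j, SolCond N c w E (fun x i => F x i j)) ∧
      F 0 = 1 ∧
      IntegrableOn (fun x => ∑ i, ∑ j, ‖F x i j‖ ^ 2) (Set.Ioi (0 : ℝ))) ∧
    (∃! F : ℝ → Matrix (Fin N) (Fin N) ℂ,
      (∀ j, SolCond N c w E (fun x i => F x i j)) ∧
      F 0 = 1 ∧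
      IntegrableOn (fun x => ∑ i, ∑ j, ‖F x i j‖ ^ 2) (Set.Iio (0 : ℝ))) := by
  refine ⟨PointInteraction.existsUnique_integrableOn_Ioi hE c w, ?_⟩
  obtain ⟨F, ⟨hF, hF0, hInt⟩, huniq⟩ :=
    PointInteraction.existsUnique_integrableOn_Ioi hE c (fun n => w (-n))
  refine ⟨fun x => F (-x), ⟨fun j => ?_, by simpa using hF0, ?_⟩, ?_⟩
  · simpa using PointInteraction.solCond_comp_neg (hF j)
  · simpa using PointInteraction.integrableOn_comp_neg hInt
  · rintro G ⟨hG, hG0, hGint⟩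
    have h := huniq (fun x => G (-x)) ⟨fun j => PointInteraction.solCond_comp_neg (hG j),
      by simpa using hG0, by simpa using PointInteraction.integrableOn_comp_neg hGint⟩
    ext1 x
    simpa using congrFun h (-x)

end
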